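/- Let n ≥ 2, let a_1, ..., a_n > 0, and let q(x) = Σ_{j=1}^n x_j²/a_j² − 1. If r is a real polynomial in x_1, ..., x_n such that Δ(q·r) = 0 identically on ℝ^n, then r = 0. Equivalently, for every m ≥ 0 the linear map T : P_m → P_m defined by T(r) = Δ(q·r), where P_m is the space of real polynomials in n variables of degree at most m, is injective. -/

import Mathlib

open MvPolynomial

theorem MvPolynomial.hasDerivAt_eval_update {σ : Type*} [DecidableEq σ] (p : MvPolynomial σ ℝ)
    (x : σ → ℝ) (j : σ) (t : ℝ) :
    HasDerivAt (fun s ↦ eval (Function.update x j s) p)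
      (eval (Function.update x j t) (pderiv j p)) t := by
  induction p using MvPolynomial.induction_on with
  | C c => simpa using hasDerivAt_const t c
  | add p q hp hq => simpa using hp.fun_add hq
  | mul_X p i hp =>
    have hX : HasDerivAt (fun s ↦ Function.update x j s i)
        (eval (Function.update x j t) (pderiv j (X i))) t := by
      rcases eq_or_ne i j with rfl | h
      · simpa using hasDerivAt_id' t
      · simpa [h, pderiv_X_of_ne h] using hasDerivAt_const t (x i)
    simpa [Derivation.leibniz, add_comm, mul_comm] using hp.fun_mul hX

/-- A function with a local maximum has nonpositive second derivative there. -/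
theorem IsLocalMax.second_deriv_nonpos {f f' : ℝ → ℝ} {t c : ℝ} (hf : ∀ s, HasDerivAt f (f' s) s)
    (hf' : HasDerivAt f' c t) (hmax : IsLocalMax f t) : c ≤ 0 := by
  have hderiv : deriv f = f' := funext fun s ↦ (hf s).deriv
  by_contra! hc
  have hmin : IsLocalMin f t := isLocalMin_of_deriv_deriv_pos
    (by rwa [hderiv, hf'.deriv]) hmax.deriv_eq_zero (hf t).continuousAt
  have hconst : f =ᶠ[nhds t] fun _ ↦ f t := by
    filter_upwards [hmax, hmin] with s h₁ h₂ using le_antisymm h₁ h₂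
  have hzero : deriv (deriv f) t = 0 := by
    rw [hconst.deriv.deriv_eq]
    simp
  rw [hderiv, hf'.deriv] at hzero
  exact hc.ne' hzero

/-- Second derivative test at a local maximum of a polynomial function. -/
theorem MvPolynomial.eval_pderiv_pderiv_nonpos_of_isLocalMax {σ : Type*} (p : MvPolynomial σ ℝ)
    {x : σ → ℝ} (hmax : IsLocalMax (fun y ↦ eval y p) x) (j : σ) :
    eval x (pderiv j (pderiv j p)) ≤ 0 := by
  classical
  have hcont : Continuous fun s : ℝ ↦ Function.update x j s :=
    continuous_const.update j continuous_id
  have hline : IsLocalMax (fun s ↦ eval (Function.update x j s) p) (x j) := by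
    have h := hcont.tendsto (x j)
    rw [Function.update_eq_self] at h
    simpa [IsLocalMax, IsMaxFilter] using h.eventually hmax
  simpa using hline.second_deriv_nonpos (hasDerivAt_eval_update p x j)
    (hasDerivAt_eval_update (pderiv j p) x j (x j))

/-- Weak maximum principle for harmonic polynomials on a compact set. -/
theorem MvPolynomial.eval_nonpos_of_harmonic {σ : Type*} [Fintype σ] [Nonempty σ]
    {p : MvPolynomial σ ℝ} (hp : ∑ j, pderiv j (pderiv j p) = 0) {K : Set (σ → ℝ)}
    (hK : IsCompact K) (hbd : ∀ x ∈ K, x ∉ interior K → eval x p ≤ 0) :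
    ∀ x ∈ K, eval x p ≤ 0 := by
  classical
  intro x hx
  set N : MvPolynomial σ ℝ := ∑ j, X j ^ 2 with hN
  have hNpos (y : σ → ℝ) : 0 ≤ eval y N := by
    simp only [hN, map_sum, map_pow, eval_X]
    positivity
  have hNlap (j : σ) : pderiv j (pderiv j N) = 2 := by
    have h2 : pderiv j (2 : MvPolynomial σ ℝ) = 0 := by exact_mod_cast (pderiv j).map_natCast 2
    simp [hN, Derivation.leibniz_pow, pderiv_X, Pi.single_apply, h2]
  obtain ⟨B, hB⟩ := hK.bddAbove_image (f := fun y ↦ eval y N) N.continuous_eval.continuousOn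
  have hstep (ε : ℝ) (hε : 0 < ε) : eval x p ≤ ε * B := by
    obtain ⟨y, hyK, hy⟩ := hK.exists_isMaxOn ⟨x, hx⟩
      (f := fun y ↦ eval y (p + C ε * N)) (p + C ε * N).continuous_eval.continuousOn
    by_cases hint : y ∈ interior K
    · have hmax : IsLocalMax (fun y ↦ eval y (p + C ε * N)) y :=
        hy.isLocalMax (mem_interior_iff_mem_nhds.mp hint)
      have hle := Finset.sum_nonpos fun j (_ : j ∈ Finset.univ) ↦
        eval_pderiv_pderiv_nonpos_of_isLocalMax _ hmax j
      rw [← map_sum] at hle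
      simp only [map_add, pderiv_C_mul, Finset.sum_add_distrib, hp, hNlap] at hle
      simp at hle
      have hcard : (0 : ℝ) < Fintype.card σ := by exact_mod_cast Fintype.card_pos
      have : 0 < (Fintype.card σ : ℝ) * (ε * 2) := by positivity
      linarith
    · have h₁ : eval x (p + C ε * N) ≤ eval y (p + C ε * N) := hy hx
      have h₂ : eval y N ≤ B := hB ⟨y, hyK, rfl⟩
      have h₃ := hbd y hyK hint
      simp only [map_add, map_mul, eval_C] at h₁
      nlinarith [mul_nonneg hε.le (hNpos x), mul_le_mul_of_nonneg_left h₂ hε.le]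
  have hlim : Filter.Tendsto (fun ε : ℝ ↦ ε * B) (nhdsWithin 0 (Set.Ioi 0)) (nhds 0) := by
    have h : Continuous fun ε : ℝ ↦ ε * B := by fun_prop
    simpa using (h.tendsto 0).mono_left nhdsWithin_le_nhds
  exact ge_of_tendsto hlim (Filter.eventually_of_mem self_mem_nhdsWithin hstep)

/-- A polynomial function vanishing near the origin comes from the zero polynomial. -/
theorem MvPolynomial.eq_zero_of_eventually_eval_eq_zero {σ : Type*} [Fintype σ]
    {p : MvPolynomial σ ℝ} (hp : ∀ᶠ x in nhds 0, eval x p = 0) : p = 0 := by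
  obtain ⟨δ, hδ, hball⟩ := Metric.eventually_nhds_iff_ball.mp hp
  refine MvPolynomial.funext_set (fun _ ↦ Metric.ball (0 : ℝ) δ) (fun _ ↦ ?_) fun x hx ↦ ?_
  · exact infinite_of_mem_nhds 0 (Metric.ball_mem_nhds 0 hδ)
  · rw [hball x (by rw [ball_pi _ hδ]; exact hx), map_zero]

/-- Injectivity of `r ↦ Δ(q·r)` where `q(x) = Σ xⱼ²/aⱼ² − 1` is the defining quadratic of an
ellipsoid: if `Δ(q·r) = 0` identically then `r = 0`.  (This is the key injectivity step,
via the maximum principle, in the proof of Proposition 1.1; injectivity of the induced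
linear map `T : P_m → P_m` is exactly this statement.) -/
theorem laplacian_ellipsoid_multiplier_injective
    (n : ℕ) (hn : 2 ≤ n) (a : Fin n → ℝ) (hpos : ∀ j, 0 < a j)
    (r : MvPolynomial (Fin n) ℝ)
    (hr : (∑ j, pderiv j (pderiv j
        (((∑ j, C ((a j) ^ 2)⁻¹ * X j ^ 2) - 1) * r))) = 0) :
    r = 0 := by
  have : Nonempty (Fin n) := ⟨⟨0, by omega⟩⟩
  set q : MvPolynomial (Fin n) ℝ := (∑ j, C ((a j) ^ 2)⁻¹ * X j ^ 2) - 1 with hq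
  have hqe (x : Fin n → ℝ) : eval x q = ∑ j, ((a j) ^ 2)⁻¹ * x j ^ 2 - 1 := by simp [hq]
  have hqc : Continuous fun x ↦ eval x q := q.continuous_eval
  set K : Set (Fin n → ℝ) := {x | eval x q ≤ 0}
  have hK : IsCompact K := by
    refine isCompact_Icc.of_isClosed_subset (isClosed_le hqc continuous_const)
      (fun x hx ↦ ?_ : K ⊆ Set.Icc (-a) a)
    have habs (j : Fin n) : |x j| ≤ a j := by
      have hj := Finset.single_le_sum (f := fun j ↦ ((a j) ^ 2)⁻¹ * x j ^ 2)
        (fun i _ ↦ by positivity) (Finset.mem_univ j)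
      have hx' : eval x q ≤ 0 := hx
      rw [hqe] at hx'
      have h₁ : ((a j) ^ 2)⁻¹ * x j ^ 2 ≤ 1 := by linarith
      rw [inv_mul_le_one₀ (pow_pos (hpos j) 2)] at h₁
      exact abs_le_of_sq_le_sq h₁ (hpos j).le
    exact ⟨fun j ↦ (abs_le.mp (habs j)).1, fun j ↦ (abs_le.mp (habs j)).2⟩
  have hbd (x : Fin n → ℝ) (hx : x ∈ K) (hxi : x ∉ interior K) : eval x q = 0 := by
    refine le_antisymm hx (not_lt.mp fun hlt ↦ hxi ?_)
    exact interior_maximal (fun y (hy : eval y q < 0) ↦ hy.le)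
      (isOpen_lt hqc continuous_const) hlt
  have hle := eval_nonpos_of_harmonic hr hK fun x hx hxi ↦ by simp [hbd x hx hxi]
  have hge := eval_nonpos_of_harmonic (p := -(q * r)) (by simp only [map_neg, Finset.sum_neg_distrib, hr, neg_zero]) hK
    fun x hx hxi ↦ by simp [hbd x hx hxi]
  refine eq_zero_of_eventually_eval_eq_zero ?_
  have hneg : ∀ᶠ x in nhds (0 : Fin n → ℝ), eval x q < 0 :=
    hqc.continuousAt.eventually_lt continuousAt_const (by rw [hqe]; simp)
  filter_upwards [hneg] with x hx
  have h₁ := hle x hx.le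
  have h₂ := hge x hx.le
  rw [map_neg] at h₂
  have h₃ : eval x q * eval x r = 0 := by
    rw [← map_mul]
    linarith
  exact (mul_eq_zero.mp h₃).resolve_left hx.ne
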